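/- For every n ≥ 1, closed choice on the discrete space {0,…,n} is strongly topologically Weihrauch reducible to choice for subsets of the unit interval of cardinality exactly n+1: C_{{0,…,n}} ≤_sW C_{[0,1],#=n+1}. -/

import Mathlib

/-! Framework: represented spaces, realizers, (strong) topological Weihrauch reducibility. -/

/-- Baire space ℕ^ℕ (with the product topology). -/
abbrev Baire : Type := ℕ → ℕ

/-- A standard pairing ⟨p, q⟩ on Baire space (interleaving). -/
def pairB (p q : Baire) : Baire := fun n => if n % 2 = 0 then p (n / 2) else q (n / 2)

/-- A representation of `X`: the name relation of a partial map from Baire space to `X`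
(`R p x` means that `p` is a name of `x`). -/
structure RepSp (X : Type*) where
  R : Baire → X → Prop

/-- Restriction of a representation to names in `A` (used for restrictions `f_A`). -/
def RepSp.restrict {X : Type*} (δ : RepSp X) (A : Set Baire) : RepSp X :=
  ⟨fun p x => δ.R p x ∧ p ∈ A⟩

/-- `F` is a realizer of the multivalued function `f` (whose domain is
`{x | (f x).Nonempty}`) with respect to the given representations. -/
def Realizes {X Y : Type*} (δX : RepSp X) (δY : RepSp Y) (f : X → Set Y)
    (F : Baire → Baire) : Prop :=
  ∀ p x, δX.R p x → (f x).Nonempty → ∃ y ∈ f x, δY.R (F p) y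

/-- Topological Weihrauch reducibility `f ≤_W g`: there are continuous partial functions
`H` (pre-processor) and `K` (post-processor) on Baire space such that
`p ↦ K⟨p, G (H p)⟩` realizes `f` for every realizer `G` of `g`. -/
def WRed {X Y U V : Type*} (δX : RepSp X) (δY : RepSp Y) (δU : RepSp U) (δV : RepSp V)
    (f : X → Set Y) (g : U → Set V) : Prop :=
  ∃ (H K : Baire → Baire) (dH dK : Set Baire), ContinuousOn H dH ∧ ContinuousOn K dK ∧
    ∀ G : Baire → Baire, Realizes δU δV g G →
      ∀ p x, δX.R p x → (f x).Nonempty →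
        p ∈ dH ∧ pairB p (G (H p)) ∈ dK ∧
          ∃ y ∈ f x, δY.R (K (pairB p (G (H p)))) y

/-- Strong topological Weihrauch reducibility `f ≤_sW g`:
`K ∘ G ∘ H` realizes `f` for every realizer `G` of `g`. -/
def SWRed {X Y U V : Type*} (δX : RepSp X) (δY : RepSp Y) (δU : RepSp U) (δV : RepSp V)
    (f : X → Set Y) (g : U → Set V) : Prop :=
  ∃ (H K : Baire → Baire) (dH dK : Set Baire), ContinuousOn H dH ∧ ContinuousOn K dK ∧
    ∀ G : Baire → Baire, Realizes δU δV g G →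
      ∀ p x, δX.R p x → (f x).Nonempty →
        p ∈ dH ∧ G (H p) ∈ dK ∧ ∃ y ∈ f x, δY.R (K (G (H p))) y

/-! Negative representation of closed subsets of a separable metric space with a
fixed dense sequence, Cauchy representation of points, and choice principles. -/

/-- An enumeration of the nonnegative rationals (as reals): `n ↦ a/(b+1)` with `(a,b)` = unpair. -/
noncomputable def ratCode (n : ℕ) : ℝ := (n.unpair.1 : ℝ) / ((n.unpair.2 : ℝ) + 1)

/-- The rational open ball of `X` coded by `n` (center from the dense sequence `α`,
rational radius; radius `0` yields the empty ball, allowing padding). -/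
noncomputable def ballCode {X : Type*} [MetricSpace X] (α : ℕ → X) (n : ℕ) : Set X :=
  Metric.ball (α n.unpair.1) (ratCode n.unpair.2)

/-- The negative representation `ψ₋` of closed sets: a name `p` enumerates rational open
balls and denotes `X` minus their union. -/
noncomputable def psiMinus {X : Type*} [MetricSpace X] (α : ℕ → X) (p : Baire) : Set X :=
  {x | ∀ i, x ∉ ballCode α (p i)}

/-- The represented space `A(X)` of closed subsets of `X` (negative information). -/
noncomputable def closedRep {X : Type*} [MetricSpace X] (α : ℕ → X) : RepSp (Set X) :=
  ⟨fun p A => A = psiMinus α p⟩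

/-- The Cauchy representation of points of `X` (w.r.t. the dense sequence `α`). -/
noncomputable def pointRep {X : Type*} [MetricSpace X] (α : ℕ → X) : RepSp X :=
  ⟨fun p x => ∀ i, dist x (α (p i)) < (2:ℝ)⁻¹ ^ i⟩

/-- Closed choice restricted to a class `𝔄` of sets: the multivalued map `A ↦ A` with
domain the nonempty members of `𝔄`. -/
def choiceFn {X : Type*} (𝔄 : Set (Set X)) : Set X → Set X :=
  fun A => {x | A ∈ 𝔄 ∧ x ∈ A}

/-- The class of (finite) sets of cardinality exactly `n`. -/
def cardEqClass (X : Type*) (n : ℕ) : Set (Set X) := {A | A.Finite ∧ A.ncard = n}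

/-- The class of nonempty (finite) sets of cardinality at most `n`. -/
def cardLeClass (X : Type*) (n : ℕ) : Set (Set X) :=
  {A | A.Finite ∧ A.Nonempty ∧ A.ncard ≤ n}

/-- The unit cube `[0,1]^n` inside `ℝ^n`. -/
def unitCube (n : ℕ) : Set (Fin n → ℝ) := Set.univ.pi fun _ => Set.Icc (0:ℝ) 1

/-- The class of nonempty closed convex subsets of the unit cube `[0,1]^n`. -/
def convexClass (n : ℕ) : Set (Set (Fin n → ℝ)) :=
  {A | A.Nonempty ∧ IsClosed A ∧ Convex ℝ A ∧ A ⊆ unitCube n}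

/-! Discrete spaces, Cantor space, products, composition, fractals. -/

/-- Cantor space `{0,1}^ℕ`, with the standard (first-difference) metric, whose topology
is the product topology. -/
noncomputable instance : MetricSpace (ℕ → Bool) := PiNat.metricSpace

/-- Representation of closed subsets of the discrete space `Fin k`:
a name enumerates the complement (`0` codes "nothing", `m+1` codes `m`). -/
def finSetRep (k : ℕ) : RepSp (Set (Fin k)) :=
  ⟨fun p A => A = {m : Fin k | ∀ i, p i ≠ (m : ℕ) + 1}⟩

/-- Representation of points of the discrete space `Fin k`: `p` names `m` iff `p 0 = m`. -/
def finPointRep (k : ℕ) : RepSp (Fin k) := ⟨fun p m => p 0 = (m : ℕ)⟩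

/-- Representation of closed subsets of the discrete space `ℕ`:
a name enumerates the complement (`0` codes "nothing", `m+1` codes `m`). -/
def natSetRep : RepSp (Set ℕ) := ⟨fun p A => A = {m : ℕ | ∀ i, p i ≠ m + 1}⟩

/-- Representation of points of the discrete space `ℕ`: `p` names `m` iff `p 0 = m`. -/
def natPointRep : RepSp ℕ := ⟨fun p m => p 0 = m⟩

/-- The `i`-th component of a name of an `n`-tuple (interleaving `n` streams). -/
def projB (n : ℕ) (i : Fin n) (p : Baire) : Baire := fun k => p (k * n + i)

/-- Representation of `n`-tuples: a name codes `n` names, interleaved. -/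
def piRep {X : Type*} (n : ℕ) (δ : RepSp X) : RepSp (Fin n → X) :=
  ⟨fun p x => ∀ i, δ.R (projB n i p) (x i)⟩

/-- The `n`-fold parallel product `f^n` of a multivalued function. -/
def piFn {X Y : Type*} (n : ℕ) (f : X → Set Y) : (Fin n → X) → Set (Fin n → Y) :=
  fun x => {y | ∀ i, y i ∈ f (x i)}

/-- Composition `g ∘ h` of multivalued functions: defined on those `t ∈ dom h` with
`h t ⊆ dom g`, mapping `t` to `⋃ {g u | u ∈ h t}`. -/
def mcomp {T U V : Type*} (g : U → Set V) (h : T → Set U) : T → Set V :=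
  fun t => {v | (h t).Nonempty ∧ (∀ u ∈ h t, (g u).Nonempty) ∧ ∃ u ∈ h t, v ∈ g u}

/-- `f` is a fractal: there is a multivalued `g` on a represented space with nonempty
carrier such that for every clopen `A` of Baire space the restriction `g_A` of `g` to
inputs with names in `A` is Weihrauch equivalent to `f`, or to the nowhere defined
function `0` (i.e. `g_A` has empty domain). -/
def Fractal {X Y : Type*} (δX : RepSp X) (δY : RepSp Y) (f : X → Set Y) : Prop :=
  ∃ (Z W : Type) (δZ : RepSp Z) (δW : RepSp W) (g : Z → Set W), Nonempty Z ∧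
    ∀ A : Set Baire, IsClopen A →
      (WRed (δZ.restrict A) δW δX δY g f ∧ WRed δX δY (δZ.restrict A) δW f g)
      ∨ ¬ ∃ p z, δZ.R p z ∧ p ∈ A ∧ (g z).Nonempty

/-- `f` is a closed fractal: as `Fractal`, with the witnessing representation total. -/
def ClosedFractal {X Y : Type*} (δX : RepSp X) (δY : RepSp Y) (f : X → Set Y) : Prop :=
  ∃ (Z W : Type) (δZ : RepSp Z) (δW : RepSp W) (g : Z → Set W), Nonempty Z ∧
    (∀ p : Baire, ∃ z, δZ.R p z) ∧
    ∀ A : Set Baire, IsClopen A →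
      (WRed (δZ.restrict A) δW δX δY g f ∧ WRed δX δY (δZ.restrict A) δW f g)
      ∨ ¬ ∃ p z, δZ.R p z ∧ p ∈ A ∧ (g z).Nonempty

/-- `X_ε(𝔄)`: the closure (in Baire space) of the set of `ψ₋`-names of sets `A ∈ 𝔄` such
that for every `x ∈ X` some `B ∈ 𝔄` satisfies `B ⊆ A \ B(x, ε)`. -/
noncomputable def Xeps {X : Type*} [MetricSpace X] (α : ℕ → X) (𝔄 : Set (Set X))
    (ε : ℝ) : Set Baire :=
  closure {p | psiMinus α p ∈ 𝔄 ∧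
    ∀ x : X, ∃ B ∈ 𝔄, B ⊆ psiMinus α p \ Metric.ball x ε}

/-- The represented space `ℝ_>`: a name is a nonincreasing sequence of rationals
converging to `x` (approximation from above). -/
noncomputable def gtRep : RepSp ℝ :=
  ⟨fun p x => (∀ i, ((Denumerable.ofNat ℚ (p (i+1)) : ℚ) : ℝ) ≤ ((Denumerable.ofNat ℚ (p i) : ℚ) : ℝ)) ∧
    Filter.Tendsto (fun i => ((Denumerable.ofNat ℚ (p i) : ℚ) : ℝ)) Filter.atTop (nhds x)⟩

open Filter Topology

section Refinement

variable {X : Type*}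

/-- Iterate a refinement rule along the sequence `p` of colours to be dropped. -/
def refineSeq (step : ℕ → Finset X → ℕ → Finset X) (F₀ : Finset X) (p : Baire) : ℕ → Finset X
  | 0 => F₀
  | j + 1 => step j (refineSeq step F₀ p j) (p j)

theorem isLocallyConstant_refineSeq (step : ℕ → Finset X → ℕ → Finset X) (F₀ : Finset X) (j : ℕ) :
    IsLocallyConstant fun p => refineSeq step F₀ p j := by
  induction j with
  | zero => exact IsLocallyConstant.const F₀
  | succ j ih =>
    have h : IsLocallyConstant fun p : Baire => p j :=
      (IsLocallyConstant.iff_continuous _).2 (continuous_apply j)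
    exact (ih.prodMk h).comp fun z => step j z.1 z.2

variable [MetricSpace X]

/-- A one-step refinement rule for finite sets of points coloured by `c`: provided `F` consists
of points of `V`, the rule drops the points of colour `v - 1` and adds points of `V` near the
remaining ones, of the same colour, so as to keep the cardinality. -/
def IsRefinement (c : X → ℕ) (V : Set X) (step : ℕ → Finset X → ℕ → Finset X) : Prop :=
  ∀ (j : ℕ) (F : Finset X) (v : ℕ), (F : Set X) ⊆ V → (∃ x ∈ F, c x + 1 ≠ v) →
    (∀ x ∈ F, c x + 1 ≠ v → x ∈ step j F v) ∧ (step j F v).card = F.card ∧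
      ∀ x ∈ step j F v, x ∈ V ∧
        ∃ y ∈ F, c y + 1 ≠ v ∧ c x = c y ∧ dist x y < (2 : ℝ)⁻¹ ^ (j + 1)

theorem exists_isRefinement [∀ x : X, NeBot (𝓝[≠] x)] (c : X → ℕ) (V : Set X)
    (hV : ∀ x ∈ V, ∀ᶠ y in 𝓝 x, y ∈ V ∧ c y = c x) :
    ∃ step, IsRefinement c V step := by
  classical
  suffices h : ∀ (j : ℕ) (F : Finset X) (v : ℕ), ∃ F' : Finset X, (F : Set X) ⊆ V →
      (∃ x ∈ F, c x + 1 ≠ v) →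
      (∀ x ∈ F, c x + 1 ≠ v → x ∈ F') ∧ F'.card = F.card ∧ ∀ x ∈ F', x ∈ V ∧
        ∃ y ∈ F, c y + 1 ≠ v ∧ c x = c y ∧ dist x y < (2 : ℝ)⁻¹ ^ (j + 1) by
    choose step hstep using h
    exact ⟨step, hstep⟩
  intro j F v
  by_cases hF : (F : Set X) ⊆ V ∧ ∃ x ∈ F, c x + 1 ≠ v
  swap
  · exact ⟨∅, fun h₁ h₂ => absurd ⟨h₁, h₂⟩ hF⟩
  obtain ⟨hFV, y, hyF, hyv⟩ := hF
  have hε : (0 : ℝ) < (2 : ℝ)⁻¹ ^ (j + 1) := by positivity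
  set G := F.filter fun x => c x + 1 ≠ v with hG
  have hGF : G ⊆ F := Finset.filter_subset _ _
  have hW : {x | (x ∈ V ∧ c x = c y) ∧ dist x y < (2 : ℝ)⁻¹ ^ (j + 1)} ∈ 𝓝 y :=
    (hV y (hFV hyF)).and (Metric.ball_mem_nhds y hε)
  obtain ⟨T, hT, hTcard⟩ :=
    ((infinite_of_mem_nhds y hW).sdiff G.finite_toSet).exists_subset_card_eq (F.card - G.card)
  have hdisj : Disjoint G T := by
    rw [Finset.disjoint_left]
    exact fun x hxG hxT => (hT hxT).2 hxG
  refine ⟨G ∪ T, fun _ _ => ⟨fun x hx hxv => ?_, ?_, fun x hx => ?_⟩⟩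
  · exact Finset.mem_union_left _ (Finset.mem_filter.2 ⟨hx, hxv⟩)
  · rw [Finset.card_union_of_disjoint hdisj, hTcard]
    have := Finset.card_le_card hGF
    omega
  · rcases Finset.mem_union.1 hx with hx | hx
    · obtain ⟨hxF, hxv⟩ := Finset.mem_filter.1 hx
      exact ⟨hFV hxF, x, hxF, hxv, rfl, by simp⟩
    · obtain ⟨⟨⟨hxV, hxc⟩, hxd⟩, -⟩ := hT hx
      exact ⟨hxV, y, hyF, hyv, hxc, hxd⟩

section Invariants

variable {c : X → ℕ} {V : Set X} {step : ℕ → Finset X → ℕ → Finset X} {F₀ : Finset X}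
  {p : Baire} {a : ℕ}

theorem refineSeq_invariant (hs : IsRefinement c V step) (hF₀ : (F₀ : Set X) ⊆ V)
    (ha : ∃ x ∈ F₀, c x = a) (hp : ∀ i, p i ≠ a + 1) (j : ℕ) :
    (refineSeq step F₀ p j : Set X) ⊆ V ∧ (refineSeq step F₀ p j).card = F₀.card ∧
      ∃ x ∈ refineSeq step F₀ p j, c x = a := by
  induction j with
  | zero => exact ⟨hF₀, rfl, ha⟩
  | succ j ih =>
    obtain ⟨hV, hcard, x, hx, hxa⟩ := ih
    have hxp : c x + 1 ≠ p j := fun h => hp j (by rw [← h, hxa])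
    obtain ⟨h₁, h₂, h₃⟩ := hs j _ (p j) hV ⟨x, hx, hxp⟩
    exact ⟨fun y hy => (h₃ y hy).1, h₂.trans hcard, x, h₁ x hx hxp, hxa⟩

theorem refineSeq_succ (hs : IsRefinement c V step) (hF₀ : (F₀ : Set X) ⊆ V)
    (ha : ∃ x ∈ F₀, c x = a) (hp : ∀ i, p i ≠ a + 1) (j : ℕ) :
    (∀ x ∈ refineSeq step F₀ p j, c x + 1 ≠ p j → x ∈ refineSeq step F₀ p (j + 1)) ∧
      ∀ x ∈ refineSeq step F₀ p (j + 1), ∃ y ∈ refineSeq step F₀ p j,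
        c y + 1 ≠ p j ∧ c x = c y ∧ dist x y < (2 : ℝ)⁻¹ ^ (j + 1) := by
  obtain ⟨hV, -, x, hx, hxa⟩ := refineSeq_invariant hs hF₀ ha hp j
  have hxp : c x + 1 ≠ p j := fun h => hp j (by rw [← h, hxa])
  obtain ⟨h₁, -, h₃⟩ := hs j _ (p j) hV ⟨x, hx, hxp⟩
  exact ⟨h₁, fun y hy => (h₃ y hy).2⟩

theorem exists_dist_refineSeq_lt (hs : IsRefinement c V step) (hF₀ : (F₀ : Set X) ⊆ V)
    (ha : ∃ x ∈ F₀, c x = a) (hp : ∀ i, p i ≠ a + 1) {j k : ℕ} (hjk : j ≤ k) {x : X}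
    (hx : x ∈ refineSeq step F₀ p k) :
    ∃ y ∈ refineSeq step F₀ p j, dist x y < (2 : ℝ)⁻¹ ^ j := by
  suffices h : ∀ x ∈ refineSeq step F₀ p k, ∃ y ∈ refineSeq step F₀ p j,
      dist x y ≤ (2 : ℝ)⁻¹ ^ j - (2 : ℝ)⁻¹ ^ k by
    obtain ⟨y, hy, hxy⟩ := h x hx
    have : (0 : ℝ) < (2 : ℝ)⁻¹ ^ k := by positivity
    exact ⟨y, hy, by linarith⟩
  clear hx x
  induction k, hjk using Nat.le_induction with
  | base => exact fun x hx => ⟨x, hx, by simp⟩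
  | succ k _ ih =>
    intro x hx
    obtain ⟨z, hz, -, -, hxz⟩ := (refineSeq_succ hs hF₀ ha hp k).2 x hx
    obtain ⟨y, hy, hzy⟩ := ih z hz
    refine ⟨y, hy, (dist_triangle x z y).trans ?_⟩
    rw [pow_succ] at hxz ⊢
    linarith

theorem antitone_image_refineSeq (hs : IsRefinement c V step) (hF₀ : (F₀ : Set X) ⊆ V)
    (ha : ∃ x ∈ F₀, c x = a) (hp : ∀ i, p i ≠ a + 1) :
    Antitone fun j => (refineSeq step F₀ p j).image c := by
  refine antitone_nat_of_succ_le fun j => Finset.image_subset_iff.2 fun x hx => ?_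
  obtain ⟨y, hy, -, hxy, -⟩ := (refineSeq_succ hs hF₀ ha hp j).2 x hx
  exact Finset.mem_image.2 ⟨y, hy, hxy.symm⟩

theorem eventually_const_refineSeq (hs : IsRefinement c V step) (hF₀ : (F₀ : Set X) ⊆ V)
    (ha : ∃ x ∈ F₀, c x = a) (hp : ∀ i, p i ≠ a + 1) :
    ∃ J, ∀ j, J ≤ j → refineSeq step F₀ p j = refineSeq step F₀ p J := by
  obtain ⟨J, hJ⟩ := WellFoundedGT.monotone_chain_condition (α := (Finset ℕ)ᵒᵈ)
    ⟨fun j => OrderDual.toDual ((refineSeq step F₀ p j).image c),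
      (antitone_image_refineSeq hs hF₀ ha hp).dual_right⟩
  have hJ' : ∀ j, J ≤ j →
      (refineSeq step F₀ p J).image c = (refineSeq step F₀ p j).image c := hJ
  refine ⟨J, fun j hj => ?_⟩
  induction j, hj using Nat.le_induction with
  | base => rfl
  | succ j hj ih =>
    obtain ⟨h₁, h₂⟩ := refineSeq_succ hs hF₀ ha hp j
    rw [← ih]
    refine (Finset.eq_of_subset_of_card_le (fun x hx => h₁ x hx ?_) ?_).symm
    · have hxc := Finset.mem_image_of_mem c hx
      rw [← hJ' j hj, hJ' (j + 1) (by omega)] at hxc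
      obtain ⟨z, hz, hzx⟩ := Finset.mem_image.1 hxc
      obtain ⟨y, -, hyp, hzy, -⟩ := h₂ z hz
      rwa [← hzx, hzy]
    · rw [(refineSeq_invariant hs hF₀ ha hp j).2.1,
        (refineSeq_invariant hs hF₀ ha hp (j + 1)).2.1]

theorem color_ne_of_eventually_const (hs : IsRefinement c V step) (hF₀ : (F₀ : Set X) ⊆ V)
    (ha : ∃ x ∈ F₀, c x = a) (hp : ∀ i, p i ≠ a + 1) {J : ℕ}
    (hJ : ∀ j, J ≤ j → refineSeq step F₀ p j = refineSeq step F₀ p J) {x : X}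
    (hx : x ∈ refineSeq step F₀ p J) (i : ℕ) : p i ≠ c x + 1 := by
  intro hi
  rw [← hJ (max J (i + 1)) (le_max_left _ _)] at hx
  have hxc := antitone_image_refineSeq hs hF₀ ha hp (le_max_right J (i + 1))
    (Finset.mem_image_of_mem c hx)
  obtain ⟨z, hz, hzx⟩ := Finset.mem_image.1 hxc
  obtain ⟨y, -, hyp, hzy, -⟩ := (refineSeq_succ hs hF₀ ha hp i).2 z hz
  exact hyp (by rw [hi, ← hzy, hzx])

end Invariants

open Classical in
/-- A negative name for the limit of a sequence of finite sets: it lists every ball that misses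
the `2⁻ʲ`-thickening of the `j`-th set for some `j`. -/
noncomputable def thickeningName (α : ℕ → X) (F : ℕ → Finset X) : Baire := fun k =>
  if Disjoint (ballCode α k.unpair.1)
    (Metric.thickening ((2 : ℝ)⁻¹ ^ k.unpair.2) (F k.unpair.2 : Set X)) then k.unpair.1 else 0

theorem ballCode_zero (α : ℕ → X) : ballCode α 0 = ∅ := by
  simp [ballCode, ratCode]

theorem exists_mem_ballCode_subset {α : ℕ → X} (hα : DenseRange α) (x : X) {ε : ℝ} (hε : 0 < ε) :
    ∃ k, x ∈ ballCode α k ∧ ballCode α k ⊆ Metric.ball x ε := by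
  obtain ⟨b, hb⟩ := exists_nat_one_div_lt (half_pos hε)
  have hb₀ : (0 : ℝ) < 1 / ((b : ℝ) + 1) := by positivity
  obtain ⟨i, hi⟩ := hα.exists_dist_lt x hb₀
  have hcode : ballCode α (Nat.pair i (Nat.pair 1 b)) = Metric.ball (α i) (1 / ((b : ℝ) + 1)) := by
    simp [ballCode, ratCode]
  refine ⟨Nat.pair i (Nat.pair 1 b), ?_, ?_⟩
  · rwa [hcode]
  · rw [hcode]
    refine Metric.ball_subset_ball' ?_
    rw [dist_comm]
    linarith

theorem psiMinus_thickeningName {α : ℕ → X} (hα : DenseRange α) {F : ℕ → Finset X} {J : ℕ}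
    (hJ : ∀ j, J ≤ j → F j = F J)
    (hF : ∀ j k, j ≤ k → ∀ x ∈ F k, ∃ y ∈ F j, dist x y < (2 : ℝ)⁻¹ ^ j) :
    psiMinus α (thickeningName α F) = F J := by
  ext x
  constructor
  · intro hx
    by_contra hxF
    have hopen : ((F J : Set X))ᶜ ∈ 𝓝 x := (F J).finite_toSet.isClosed.isOpen_compl.mem_nhds hxF
    obtain ⟨ε, hε, hball⟩ := Metric.mem_nhds_iff.1 hopen
    obtain ⟨k, hxk, hk⟩ := exists_mem_ballCode_subset hα x (half_pos hε)
    obtain ⟨N, hN⟩ := exists_pow_lt_of_lt_one (half_pos hε) (by norm_num : (2 : ℝ)⁻¹ < 1)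
    have hpow : (2 : ℝ)⁻¹ ^ max J N < ε / 2 :=
      (pow_le_pow_of_le_one (by norm_num) (by norm_num) (le_max_right J N)).trans_lt hN
    have hdisj : Disjoint (ballCode α k)
        (Metric.thickening ((2 : ℝ)⁻¹ ^ max J N) (F (max J N) : Set X)) := by
      rw [Set.disjoint_left]
      intro z hz hz'
      rw [hJ _ (le_max_left J N)] at hz'
      obtain ⟨y, hy, hzy⟩ := Metric.mem_thickening_iff.1 hz'
      refine hball ?_ hy
      have hzx := Metric.mem_ball.1 (hk hz)
      rw [Metric.mem_ball]
      linarith [dist_triangle_left y x z]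
    refine hx (Nat.pair k (max J N)) ?_
    unfold thickeningName
    rw [if_pos (by simpa only [Nat.unpair_pair] using hdisj)]
    simpa only [Nat.unpair_pair] using hxk
  · intro hx k
    unfold thickeningName
    split_ifs with hdisj
    · intro hxk
      refine Set.disjoint_left.1 hdisj hxk (Metric.mem_thickening_iff.2 ?_)
      refine hF _ (max J k.unpair.2) (le_max_right _ _) x ?_
      rw [hJ _ (le_max_left _ _)]
      exact hx
    · simp [ballCode_zero]

end Refinement

/-- The nearest multiple of `1 / n`, as a colour of points of the unit interval. -/
noncomputable def nearestColor (n : ℕ) (x : Set.Icc (0 : ℝ) 1) : ℕ := ⌊(n : ℝ) * x + 1 / 2⌋₊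

/-- The points of the unit interval at distance less than `1 / (4 n)` from a multiple
of `1 / n`. -/
def nearGrid (n : ℕ) : Set (Set.Icc (0 : ℝ) 1) := {x | |(n : ℝ) * x - nearestColor n x| < 1 / 4}

theorem nearestColor_eq {n m : ℕ} {x : Set.Icc (0 : ℝ) 1} (h : |(n : ℝ) * x - m| < 1 / 2) :
    nearestColor n x = m := by
  have h' := abs_lt.1 h
  refine (Nat.floor_eq_iff ?_).2 ⟨by linarith, by linarith⟩
  have : (0 : ℝ) ≤ m := m.cast_nonneg
  linarith

theorem nearestColor_lt (n : ℕ) (x : Set.Icc (0 : ℝ) 1) : nearestColor n x < n + 1 := by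
  have hx : (n : ℝ) * x ≤ n := mul_le_of_le_one_right n.cast_nonneg x.2.2
  have hx₀ : (0 : ℝ) ≤ (n : ℝ) * x := mul_nonneg n.cast_nonneg x.2.1
  refine (Nat.floor_lt (by linarith)).2 ?_
  push_cast
  linarith

theorem nearestColor_eq_of_dist {n : ℕ} {x y : Set.Icc (0 : ℝ) 1} (hx : x ∈ nearGrid n)
    (h : (n : ℝ) * dist x y ≤ 1 / 4) : nearestColor n y = nearestColor n x := by
  refine nearestColor_eq ?_
  have hx' : |(n : ℝ) * x - nearestColor n x| < 1 / 4 := hx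
  have h' : |(n : ℝ) * x - n * y| ≤ 1 / 4 := by
    rwa [← mul_sub, abs_mul, Nat.abs_cast, ← Real.dist_eq, ← Subtype.dist_eq]
  have h₁ := abs_lt.1 hx'
  have h₂ := abs_le.1 h'
  exact abs_lt.2 ⟨by linarith, by linarith⟩

theorem eventually_nearGrid {n : ℕ} {x : Set.Icc (0 : ℝ) 1} (hx : x ∈ nearGrid n) :
    ∀ᶠ y in 𝓝 x, y ∈ nearGrid n ∧ nearestColor n y = nearestColor n x := by
  have hcont : Continuous fun y : Set.Icc (0 : ℝ) 1 => |(n : ℝ) * y - nearestColor n x| := by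
    fun_prop
  filter_upwards [hcont.continuousAt.eventually_lt continuousAt_const hx] with y hy
  have hc : nearestColor n y = nearestColor n x := nearestColor_eq (hy.trans (by norm_num))
  refine ⟨?_, hc⟩
  change |(n : ℝ) * y - nearestColor n y| < 1 / 4
  rwa [hc]

theorem exists_grid {n : ℕ} (hn : 1 ≤ n) :
    ∃ F : Finset (Set.Icc (0 : ℝ) 1), (F : Set _) ⊆ nearGrid n ∧ F.card = n + 1 ∧
      ∀ m < n + 1, ∃ x ∈ F, nearestColor n x = m := by
  classical
  have hn₀ : (0 : ℝ) < n := by exact_mod_cast hn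
  let g : Fin (n + 1) → Set.Icc (0 : ℝ) 1 := fun m =>
    ⟨(m : ℕ) / n, by positivity, (div_le_one hn₀).2 (by exact_mod_cast Nat.lt_succ_iff.1 m.2)⟩
  have hg : ∀ m, (n : ℝ) * (g m : ℝ) = (m : ℕ) := fun m => mul_div_cancel₀ _ hn₀.ne'
  have hgc : ∀ m, nearestColor n (g m) = m := fun m => nearestColor_eq (by rw [hg]; norm_num)
  have hinj : Function.Injective g := fun a b hab => Fin.ext (by rw [← hgc a, hab, hgc])
  refine ⟨Finset.univ.image g, ?_, ?_, fun m hm => ?_⟩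
  · intro x hx
    obtain ⟨m, -, rfl⟩ := Finset.mem_image.1 hx
    change |(n : ℝ) * (g m : ℝ) - nearestColor n (g m)| < 1 / 4
    rw [hgc, hg]
    norm_num
  · rw [Finset.card_image_of_injective _ hinj, Finset.card_fin]
  · exact ⟨g ⟨m, hm⟩, Finset.mem_image_of_mem g (Finset.mem_univ _), hgc _⟩

/-- For every n ≥ 1, C_{{0,…,n}} ≤_sW C_{[0,1],#=n+1}. -/
theorem stmt4 (n : ℕ) (hn : 1 ≤ n) (α : ℕ → ↥(Set.Icc (0:ℝ) 1)) (hα : DenseRange α) :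
    SWRed (finSetRep (n + 1)) (finPointRep (n + 1)) (closedRep α) (pointRep α)
        (choiceFn Set.univ) (choiceFn (cardEqClass ↥(Set.Icc (0:ℝ) 1) (n + 1))) := by
  obtain ⟨F₀, hF₀, hcard, hcol⟩ := exists_grid hn
  obtain ⟨step, hs⟩ := exists_isRefinement (nearestColor n) (nearGrid n)
    fun x hx => eventually_nearGrid hx
  have hn₀ : (0 : ℝ) < n := by exact_mod_cast hn
  obtain ⟨N, hN⟩ := exists_pow_lt_of_lt_one (show (0 : ℝ) < 1 / 4 / n by positivity)
    (by norm_num : (2 : ℝ)⁻¹ < 1)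
  refine ⟨fun p => thickeningName α (refineSeq step F₀ p),
    fun q _ => nearestColor n (α (q N)), Set.univ, Set.univ, ?_, ?_, ?_⟩
  · refine (continuous_pi fun k => ?_).continuousOn
    exact ((isLocallyConstant_refineSeq step F₀ k.unpair.2).comp fun F =>
      thickeningName α (fun _ => F) k).continuous
  · refine (continuous_pi fun _ => ?_).continuousOn
    exact (continuous_of_discreteTopology (f := fun i => nearestColor n (α i))).comp
      (continuous_apply N)
  · rintro G hG p A hpA ⟨a, -, haA⟩
    have hA : A = {m : Fin (n + 1) | ∀ i, p i ≠ (m : ℕ) + 1} := hpA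
    have hp : ∀ i, p i ≠ (a : ℕ) + 1 := by
      rw [hA] at haA
      exact haA
    have ha := hcol a a.2
    obtain ⟨J, hJ⟩ := eventually_const_refineSeq hs hF₀ ha hp
    obtain ⟨-, hJcard, x₀, hx₀, -⟩ := refineSeq_invariant hs hF₀ ha hp J
    have hpsi := psiMinus_thickeningName hα hJ
      fun _ _ hjk _ hx => exists_dist_refineSeq_lt hs hF₀ ha hp hjk hx
    obtain ⟨y, ⟨-, hy⟩, hyG⟩ := hG (thickeningName α (refineSeq step F₀ p))
      (refineSeq step F₀ p J) hpsi.symm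
      ⟨x₀, ⟨Finset.finite_toSet _, by rw [Set.ncard_coe_finset, hJcard, hcard]⟩, hx₀⟩
    have hyV := (refineSeq_invariant hs hF₀ ha hp J).1 hy
    refine ⟨trivial, trivial, ⟨nearestColor n y, nearestColor_lt n y⟩, ⟨trivial, ?_⟩, ?_⟩
    · rw [hA]
      exact color_ne_of_eventually_const hs hF₀ ha hp hJ hy
    · refine nearestColor_eq_of_dist hyV ?_
      have h := ((hyG N).trans hN).le
      rwa [le_div_iff₀' hn₀] at h
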